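/- Every connected coaugmented cograded coalgebra (C, Δ, ε, u) over a commutative ring k is conilpotent: for every x ∈ ker ε there exists n ≥ 1 such that Δ̄^n(x) = 0, where Δ̄(x) = Δ(x) − x ⊗ u(1) − u(1) ⊗ x, Δ̄^1 = Δ̄ and Δ̄^{m+1} = (id_C ⊗ Δ̄^m) ∘ Δ̄. Moreover, for x ∈ C^(n) ∩ ker ε one has Δ̄^m(x) = 0 for all m ≥ n. -/

import Mathlib

open TensorProduct

universe u v

/-- The image of `P ⊗ Q` in `C ⊗ C`, for submodules `P Q : Submodule k C`. -/
noncomputable def tensorImage {k C : Type*} [CommRing k] [AddCommGroup C] [Module k C]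
    (P Q : Submodule k C) : Submodule k (C ⊗[k] C) :=
  LinearMap.range (TensorProduct.map P.subtype Q.subtype)

/-- `Tpow k C m` is the `(m+1)`-fold iterated tensor power `C ⊗ (C ⊗ (⋯ ⊗ C))`. -/
noncomputable def Tpow (k : Type u) (C : Type v) [CommRing k] [AddCommGroup C] [Module k C] :
    ℕ → ModuleCat.{v} k
  | 0 => ModuleCat.of k C
  | (n + 1) => ModuleCat.of k (C ⊗[k] (Tpow k C n))

/-- Iterates of a map `Δ̄ : C → C ⊗ C`: `Δ̄^0 = id` and `Δ̄^{m+1} = (id_C ⊗ Δ̄^m) ∘ Δ̄`.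
In particular `Δ̄^1 = (id_C ⊗ id) ∘ Δ̄ = Δ̄`, and `Δ̄^m : C → C^{⊗(m+1)}`. -/
noncomputable def reducedComulIterate {k : Type u} {C : Type v}
    [CommRing k] [AddCommGroup C] [Module k C]
    (Dbar : C →ₗ[k] C ⊗[k] C) : (m : ℕ) → (C →ₗ[k] Tpow k C m)
  | 0 => LinearMap.id
  | (m + 1) => (LinearMap.lTensor C (reducedComulIterate Dbar m)) ∘ₗ Dbar

/-- The reduced coproduct `Δ̄(x) = Δ(x) - x ⊗ u(1) - u(1) ⊗ x` as a linear map. -/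
noncomputable def reducedComul {k C : Type*} [CommRing k] [AddCommGroup C] [Module k C]
    [Coalgebra k C] (u : k →ₗ[k] C) : C →ₗ[k] C ⊗[k] C :=
  Coalgebra.comul - (TensorProduct.mk k C C).flip (u 1) - TensorProduct.mk k C C (u 1)

section

variable {k : Type u} {C : Type v} [CommRing k] [AddCommGroup C] [Module k C]

/-- If `f` maps `P` to `P'` and `g` maps `Q` to `Q'`, then `f ⊗ g` maps the image of `P ⊗ Q` to
the image of `P' ⊗ Q'`. -/
lemma map_mem_tensorImage {P Q P' Q' : Submodule k C} {f g : C →ₗ[k] C}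
    (hf : ∀ x ∈ P, f x ∈ P') (hg : ∀ x ∈ Q, g x ∈ Q') {z : C ⊗[k] C} (hz : z ∈ tensorImage P Q) :
    TensorProduct.map f g z ∈ tensorImage P' Q' := by
  obtain ⟨t, rfl⟩ := hz
  induction t with
  | zero => simp
  | add a b ha hb => simpa using add_mem ha hb
  | tmul a b => exact ⟨⟨f a, hf a a.2⟩ ⊗ₜ ⟨g b, hg b b.2⟩, rfl⟩

lemma tensorImage_bot_left (Q : Submodule k C) : tensorImage ⊥ Q = ⊥ := by
  have h : (⊥ : Submodule k C).subtype = 0 := LinearMap.ext fun y => y.2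
  simp [tensorImage, h, TensorProduct.map_zero_left]

lemma tensorImage_bot_right (P : Submodule k C) : tensorImage P ⊥ = ⊥ := by
  have h : (⊥ : Submodule k C).subtype = 0 := LinearMap.ext fun y => y.2
  simp [tensorImage, h, TensorProduct.map_zero_right]

lemma lTensor_eq_zero_of_mem_tensorImage {M : Type*} [AddCommGroup M] [Module k M]
    {P Q : Submodule k C} {f : C →ₗ[k] M} (hf : ∀ x ∈ Q, f x = 0) {z : C ⊗[k] C}
    (hz : z ∈ tensorImage P Q) : LinearMap.lTensor C f z = 0 := by
  obtain ⟨t, rfl⟩ := hz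
  induction t with
  | zero => simp
  | add a b ha hb => simp [ha, hb]
  | tmul a b => simp [hf b b.2]

variable [Coalgebra k C]

/-- On `ker ε` the reduced coproduct is `((id - u ε) ⊗ (id - u ε)) ∘ Δ`. -/
lemma reducedComul_eq_map_comul (u : k →ₗ[k] C) {x : C}
    (hx : Coalgebra.counit (R := k) x = 0) :
    reducedComul u x =
      TensorProduct.map (LinearMap.id - u ∘ₗ Coalgebra.counit)
        (LinearMap.id - u ∘ₗ Coalgebra.counit) (Coalgebra.comul x) := by
  have hl : TensorProduct.map (u ∘ₗ Coalgebra.counit) LinearMap.id (Coalgebra.comul x) =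
      u 1 ⊗ₜ[k] x := by
    have h := congrArg (LinearMap.rTensor C u) (Coalgebra.rTensor_counit_comul (R := k) x)
    rwa [← LinearMap.rTensor_comp_apply, LinearMap.rTensor_tmul] at h
  have hr : TensorProduct.map LinearMap.id (u ∘ₗ Coalgebra.counit) (Coalgebra.comul x) =
      x ⊗ₜ[k] u 1 := by
    have h := congrArg (LinearMap.lTensor C u) (Coalgebra.lTensor_counit_comul (R := k) x)
    rwa [← LinearMap.lTensor_comp_apply, LinearMap.lTensor_tmul] at h
  have hlr : TensorProduct.map (u ∘ₗ Coalgebra.counit) (u ∘ₗ Coalgebra.counit)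
      (Coalgebra.comul x) = 0 := by
    have h := congrArg (LinearMap.lTensor C (u ∘ₗ Coalgebra.counit)) hl
    rw [LinearMap.lTensor, ← LinearMap.comp_apply, ← TensorProduct.map_comp] at h
    simpa [hx] using h
  rw [← TensorProduct.mapBilinear_apply (R := k)]
  simp only [map_sub, LinearMap.sub_apply, TensorProduct.mapBilinear_apply, hl, hr,
    hlr, TensorProduct.map_id, LinearMap.id_apply, reducedComul, LinearMap.flip_apply,
    TensorProduct.mk_apply]
  abel

/-- In a connected cograded coalgebra, the reduced coproduct of a homogeneous element of `ker ε`
only has components of positive bidegree. -/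
lemma reducedComul_mem_iSup {u : k →ₗ[k] C} {𝒞 : ℕ → Submodule k C}
    (hzero : ∀ x ∈ 𝒞 0, u (Coalgebra.counit (R := k) x) = x)
    (hpos : ∀ n, 1 ≤ n → ∀ x ∈ 𝒞 n, Coalgebra.counit (R := k) x = 0) {n : ℕ} {x : C}
    (hx : Coalgebra.comul x ∈ ⨆ (p : ℕ) (q : ℕ) (_ : p + q = n), tensorImage (𝒞 p) (𝒞 q))
    (hε : Coalgebra.counit (R := k) x = 0) :
    reducedComul u x ∈ ⨆ (p : ℕ) (q : ℕ) (_ : (1 ≤ p ∧ 1 ≤ q) ∧ p + q = n),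
      tensorImage (𝒞 p) (𝒞 q) := by
  rw [reducedComul_eq_map_comul u hε]
  set f : C →ₗ[k] C := LinearMap.id - u ∘ₗ Coalgebra.counit with hf
  have hf0 : ∀ y ∈ 𝒞 0, f y ∈ (⊥ : Submodule k C) := fun y hy => by simp [hf, hzero y hy]
  have hfn : ∀ p, ∀ y ∈ 𝒞 p, f y ∈ 𝒞 p := fun p y hy => by
    rcases Nat.eq_zero_or_pos p with rfl | hp
    · simp [hf, hzero y hy]
    · simpa [hf, hpos p hp y hy] using hy
  rw [← Submodule.mem_comap]
  refine (iSup_le fun p => iSup_le fun q => iSup_le fun hpq => ?_ :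
    _ ≤ Submodule.comap (TensorProduct.map f f) _) hx
  intro z hz
  rw [Submodule.mem_comap]
  rcases Nat.eq_zero_or_pos p with rfl | hp
  · have h := map_mem_tensorImage hf0 (hfn q) hz
    rw [tensorImage_bot_left, Submodule.mem_bot] at h
    simp [h]
  rcases Nat.eq_zero_or_pos q with rfl | hq
  · have h := map_mem_tensorImage (hfn p) hf0 hz
    rw [tensorImage_bot_right, Submodule.mem_bot] at h
    simp [h]
  · exact Submodule.mem_iSup_of_mem p <| Submodule.mem_iSup_of_mem q <|
      Submodule.mem_iSup_of_mem ⟨⟨hp, hq⟩, hpq⟩ (map_mem_tensorImage (hfn p) (hfn q) hz)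

lemma reducedComulIterate_eq_zero {u : k →ₗ[k] C} {𝒞 : ℕ → Submodule k C}
    (hcomul : ∀ n, ∀ x ∈ 𝒞 n, Coalgebra.comul x ∈
      ⨆ (p : ℕ) (q : ℕ) (_ : p + q = n), tensorImage (𝒞 p) (𝒞 q))
    (hzero : ∀ x ∈ 𝒞 0, u (Coalgebra.counit (R := k) x) = x)
    (hpos : ∀ n, 1 ≤ n → ∀ x ∈ 𝒞 n, Coalgebra.counit (R := k) x = 0) {m n : ℕ} (hn : 1 ≤ n)
    (hnm : n ≤ m) {x : C} (hx : x ∈ 𝒞 n) : reducedComulIterate (reducedComul u) m x = 0 := by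
  induction m generalizing n x with
  | zero => omega
  | succ m ih =>
    have h := reducedComul_mem_iSup hzero hpos (hcomul n x hx) (hpos n hn x hx)
    refine LinearMap.mem_ker.mp ((iSup_le fun p => iSup_le fun q => iSup_le fun hpq => ?_ :
      _ ≤ LinearMap.ker (LinearMap.lTensor C (reducedComulIterate (reducedComul u) m))) h)
    intro z hz
    exact lTensor_eq_zero_of_mem_tensorImage (fun y hy => ih hpq.1.2 (by omega) hy) hz

end

/-- Every connected coaugmented cograded coalgebra `(C, Δ, ε, u)` over a
commutative ring `k` is conilpotent: for every `x ∈ ker ε` there exists `n ≥ 1` with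
`Δ̄ⁿ(x) = 0`. Moreover, for `x ∈ C⁽ⁿ⁾ ∩ ker ε` one has `Δ̄^m(x) = 0` for all `m ≥ n`. -/
theorem conilpotent_of_connected_cograded
    {k : Type u} {C : Type v} [CommRing k] [AddCommGroup C] [Module k C] [Coalgebra k C]
    (u : k →ₗ[k] C)
    (hu : (Coalgebra.counit (R := k) (A := C)) ∘ₗ u = LinearMap.id)
    (𝒞 : ℕ → Submodule k C)
    (hinternal : DirectSum.IsInternal 𝒞)
    (hcomul : ∀ n, ∀ x ∈ 𝒞 n, Coalgebra.comul x ∈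
      ⨆ (p : ℕ) (q : ℕ) (_ : p + q = n), tensorImage (𝒞 p) (𝒞 q))
    (hker : (⨆ (n : ℕ) (_ : 1 ≤ n), 𝒞 n) ≤
      LinearMap.ker (Coalgebra.counit (R := k) (A := C)))
    (hconn : 𝒞 0 = LinearMap.range u) :
    (∀ x ∈ LinearMap.ker (Coalgebra.counit (R := k) (A := C)),
      ∃ n, 1 ≤ n ∧ reducedComulIterate (reducedComul u) n x = 0) ∧
    (∀ n, ∀ x ∈ 𝒞 n ⊓ LinearMap.ker (Coalgebra.counit (R := k) (A := C)),
      ∀ m, n ≤ m → reducedComulIterate (reducedComul u) m x = 0) := by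
  have hzero : ∀ x ∈ 𝒞 0, u (Coalgebra.counit (R := k) x) = x := by
    intro x hx
    rw [hconn] at hx
    obtain ⟨a, rfl⟩ := hx
    exact congrArg u (LinearMap.congr_fun hu a)
  have hpos : ∀ n, 1 ≤ n → ∀ x ∈ 𝒞 n, Coalgebra.counit (R := k) x = 0 := fun n hn x hx =>
    hker (Submodule.mem_iSup_of_mem n (Submodule.mem_iSup_of_mem hn hx))
  refine ⟨fun x hx => ?_, fun n x hx m hnm => ?_⟩
  · have key : ∀ y : C, ∃ N, ∀ m, N ≤ m →
        reducedComulIterate (reducedComul u) m (y - u (Coalgebra.counit (R := k) y)) = 0 := by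
      intro y
      have hy : y ∈ iSup 𝒞 := by simp [hinternal.submodule_iSup_eq_top]
      induction hy using Submodule.iSup_induction' with
      | mem n y hy =>
        refine ⟨n, fun m hnm => ?_⟩
        rcases Nat.eq_zero_or_pos n with rfl | hn
        · rw [hzero y hy, sub_self, map_zero]
        · rw [hpos n hn y hy, map_zero, sub_zero]
          exact reducedComulIterate_eq_zero hcomul hzero hpos hn hnm hy
      | zero => exact ⟨0, fun m _ => by simp⟩
      | add y z _ _ hy hz =>
        obtain ⟨N, hN⟩ := hy
        obtain ⟨N', hN'⟩ := hz
        refine ⟨max N N', fun m hm => ?_⟩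
        rw [map_add, map_add, add_sub_add_comm, map_add, hN m (le_of_max_le_left hm),
          hN' m (le_of_max_le_right hm), add_zero]
    obtain ⟨N, hN⟩ := key x
    refine ⟨N + 1, by omega, ?_⟩
    simpa [LinearMap.mem_ker.mp hx] using hN (N + 1) (by omega)
  · obtain ⟨hx, hε⟩ := hx
    rcases Nat.eq_zero_or_pos n with rfl | hn
    · rw [← hzero x hx, LinearMap.mem_ker.mp hε, map_zero, map_zero]
    · exact reducedComulIterate_eq_zero hcomul hzero hpos hn hnm hx
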